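/- arXiv:1602.09110 — 2 statements merged into one kernel-verified Lean document; each statement's English description precedes it below -/
import Mathlib

section
/- Let 𝛃 ∈ ℝ⁴ be future-directed timelike (β₀ > ‖𝛃⃗‖) and set 𝛃² = η(𝛃,𝛃). For p ∈ ℝ³ let P(p) = (‖p‖, p) ∈ ℝ⁴. Then for all μ, ν ∈ {0,1,2,3} the function p ↦ (P(p)_μ P(p)_ν/‖p‖)(e^{η(𝛃,P(p))} − 1)⁻¹ is integrable on ℝ³ and (2π)⁻³ ∫_{ℝ³} (P(p)_μ P(p)_ν/‖p‖)(e^{η(𝛃,P(p))} − 1)⁻¹ dp = (π²/90)(4𝛃_μ𝛃_ν − 𝛃² g_{μν})(𝛃²)⁻³, where g = diag(1,−1,−1,−1). (Lorentz-covariant formula for the thermal stress-energy tensor E_{μν}(𝛃) of the massless Klein–Gordon field.) -/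
open MeasureTheory Real

/-- Minkowski product on ℝ⁴ with signature (+,-,-,-). -/
noncomputable def minkowski (x y : Fin 4 → ℝ) : ℝ :=
  x 0 * y 0 - x 1 * y 1 - x 2 * y 2 - x 3 * y 3

/-- The open forward light cone V₊ ⊂ ℝ⁴. -/
def forwardCone : Set (Fin 4 → ℝ) :=
  {x | x 0 > Real.sqrt ((x 1) ^ 2 + (x 2) ^ 2 + (x 3) ^ 2)}

/-- Minkowski metric tensor g = diag(1,−1,−1,−1). -/
def minkowskiMetric (μ ν : Fin 4) : ℝ :=
  if μ = ν then (if μ = 0 then 1 else -1) else 0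

/-- The on-shell four-momentum P(p) = (‖p‖, p) for p ∈ ℝ³. -/
noncomputable def onShell (p : EuclideanSpace ℝ (Fin 3)) : Fin 4 → ℝ :=
  ![‖p‖, p 0, p 1, p 2]

open ProbabilityTheory Set Filter Topology
open scoped ENNReal

lemma lintegral_radial_exp_neg_mul_sqrt {a : ℝ} (ha : 0 < a) (z : ℝ) :
    ∫⁻ r in Ioi (0 : ℝ), ENNReal.ofReal r *
      ENNReal.ofReal (exp (-a * √(z ^ 2 + r ^ 2)) / √(z ^ 2 + r ^ 2)) =
      ENNReal.ofReal (exp (-a * |z|) / a) := by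
  have hderiv : ∀ r ∈ Ioi (0 : ℝ), HasDerivAt (fun r ↦ -(exp (-a * √(z ^ 2 + r ^ 2)) / a))
      (r * (exp (-a * √(z ^ 2 + r ^ 2)) / √(z ^ 2 + r ^ 2))) r := by
    intro r hr
    have hr : 0 < r := hr
    have hpos : 0 < z ^ 2 + r ^ 2 := by positivity
    have hs := sqrt_pos.2 hpos
    have h := (((((hasDerivAt_pow 2 r).const_add (z ^ 2)).sqrt hpos.ne').const_mul
      (-a)).exp.div_const a).neg
    refine h.congr_deriv ?_
    field_simp
    ring
  have hcont : ContinuousWithinAt (fun r ↦ -(exp (-a * √(z ^ 2 + r ^ 2)) / a)) (Ici 0) 0 := by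
    apply Continuous.continuousWithinAt
    fun_prop
  have hpos : ∀ r ∈ Ioi (0 : ℝ), 0 ≤ r * (exp (-a * √(z ^ 2 + r ^ 2)) / √(z ^ 2 + r ^ 2)) := by
    intro r hr
    have hr : 0 < r := hr
    positivity
  have hsqrt : Tendsto (fun r : ℝ ↦ √(z ^ 2 + r ^ 2)) atTop atTop :=
    tendsto_sqrt_atTop.comp
      (tendsto_atTop_add_const_left _ _ (tendsto_pow_atTop two_ne_zero))
  have hlim : Tendsto (fun r ↦ -(exp (-a * √(z ^ 2 + r ^ 2)) / a)) atTop (𝓝 0) := by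
    have h := ((tendsto_exp_atBot.comp (hsqrt.const_mul_atTop_of_neg (neg_lt_zero.2 ha))).div_const
      a).neg
    simpa using h
  have hint := integrableOn_Ioi_deriv_of_nonneg hcont hderiv hpos hlim
  have hval := integral_Ioi_of_hasDerivAt_of_nonneg hcont hderiv hpos hlim
  simp only [ne_eq, OfNat.ofNat_ne_zero, not_false_eq_true, zero_pow, add_zero, sqrt_sq_eq_abs,
    sub_neg_eq_add, zero_add] at hval
  rw [← hval, ofReal_integral_eq_lintegral_ofReal hint
    ((ae_restrict_iff' measurableSet_Ioi).2 (ae_of_all _ hpos))]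
  refine setLIntegral_congr_fun measurableSet_Ioi fun r hr ↦ ?_
  rw [ENNReal.ofReal_mul (le_of_lt hr)]

lemma lintegral_plane_exp_neg_mul_sqrt {a : ℝ} (ha : 0 < a) (z : ℝ) :
    ∫⁻ q : ℝ × ℝ, ENNReal.ofReal (exp (-a * √(z ^ 2 + (q.1 ^ 2 + q.2 ^ 2))) /
      √(z ^ 2 + (q.1 ^ 2 + q.2 ^ 2))) = ENNReal.ofReal (2 * π / a * exp (-a * |z|)) := by
  have hpolar (p : ℝ × ℝ) :
      (polarCoord.symm p).1 ^ 2 + (polarCoord.symm p).2 ^ 2 = p.1 ^ 2 := by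
    simp only [polarCoord_symm_apply]
    linear_combination p.1 ^ 2 * cos_sq_add_sin_sq p.2
  rw [← lintegral_comp_polarCoord_symm]
  simp_rw [hpolar, smul_eq_mul]
  rw [polarCoord_target, Measure.volume_eq_prod, setLIntegral_prod _ (by fun_prop)]
  simp only [lintegral_const, MeasurableSet.univ, Measure.restrict_apply, univ_inter,
    Real.volume_Ioo, sub_neg_eq_add]
  rw [lintegral_mul_const _ (by fun_prop), lintegral_radial_exp_neg_mul_sqrt ha,
    ← ENNReal.ofReal_mul (by positivity)]
  congr 1
  ring

lemma lintegral_exp_mul_sub_mul_abs {a b : ℝ} (h : |b| < a) :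
    ∫⁻ z : ℝ, ENNReal.ofReal (exp (b * z - a * |z|)) =
      ENNReal.ofReal (2 * a / (a ^ 2 - b ^ 2)) := by
  obtain ⟨h₁, h₂⟩ := abs_lt.1 h
  have hl : ∫⁻ z in Iic (0 : ℝ), ENNReal.ofReal (exp (b * z - a * |z|)) =
      ENNReal.ofReal (1 / (a + b)) := by
    rw [setLIntegral_congr_fun (g := fun z ↦ ENNReal.ofReal (exp ((a + b) * z))) measurableSet_Iic
      fun z hz ↦ by rw [abs_of_nonpos hz]; ring_nf]
    rw [← ofReal_integral_eq_lintegral_ofReal (integrableOn_exp_mul_Iic (by linarith) 0)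
      (ae_of_all _ fun _ ↦ (exp_pos _).le), integral_exp_mul_Iic (by linarith)]
    simp
  have hr : ∫⁻ z in Ioi (0 : ℝ), ENNReal.ofReal (exp (b * z - a * |z|)) =
      ENNReal.ofReal (1 / (a - b)) := by
    rw [setLIntegral_congr_fun (g := fun z ↦ ENNReal.ofReal (exp ((b - a) * z))) measurableSet_Ioi
      fun z hz ↦ by rw [abs_of_pos hz]; ring_nf]
    rw [← ofReal_integral_eq_lintegral_ofReal (integrableOn_exp_mul_Ioi (by linarith) 0)
      (ae_of_all _ fun _ ↦ (exp_pos _).le), integral_exp_mul_Ioi (by linarith)]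
    rw [mul_zero, exp_zero, neg_div, ← div_neg, neg_sub]
  rw [← lintegral_add_compl _ (measurableSet_Iic (a := (0 : ℝ))), compl_Iic, hl, hr,
    ← ENNReal.ofReal_add (one_div_nonneg.2 (by linarith)) (one_div_nonneg.2 (by linarith))]
  have : a + b ≠ 0 := by linarith
  have : a - b ≠ 0 := by linarith
  have : a ^ 2 - b ^ 2 ≠ 0 := by
    rw [sq_sub_sq]; positivity
  congr 1
  field_simp
  ring

lemma lintegral_euclideanSpace_three {f : EuclideanSpace ℝ (Fin 3) → ℝ≥0∞} (hf : Measurable f) :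
    ∫⁻ p, f p = ∫⁻ z : ℝ, ∫⁻ q : ℝ × ℝ, f !₂[z, q.1, q.2] := by
  have h₁ := (EuclideanSpace.volume_preserving_symm_measurableEquiv_toLp (Fin 3)).symm
  have h₂ := (volume_preserving_piFinSuccAbove (fun _ : Fin 3 ↦ ℝ) 0).symm
  have hg := (hf.comp h₁.measurable).comp h₂.measurable
  rw [← h₁.lintegral_comp hf, ← h₂.lintegral_comp (by exact hf.comp h₁.measurable),
    Measure.volume_eq_prod, lintegral_prod _ (by exact hg.aemeasurable)]
  refine lintegral_congr fun z ↦ ?_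
  rw [← (volume_preserving_piFinTwo fun _ ↦ ℝ).symm.lintegral_comp
    (by exact hg.comp measurable_prodMk_left)]
  refine lintegral_congr fun q ↦ ?_
  congr 1
  ext i
  fin_cases i <;> rfl

lemma lintegral_lightCone_exp_axis {a c : ℝ} (h : |c| < a) :
    ∫⁻ p : EuclideanSpace ℝ (Fin 3), ENNReal.ofReal (exp (-(a * ‖p‖ - c * p 0)) / ‖p‖) =
      ENNReal.ofReal (4 * π / (a ^ 2 - c ^ 2)) := by
  have ha : 0 < a := (abs_nonneg c).trans_lt h
  rw [lintegral_euclideanSpace_three (by fun_prop)]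
  have hnorm (z : ℝ) (q : ℝ × ℝ) :
      ‖(!₂[z, q.1, q.2] : EuclideanSpace ℝ (Fin 3))‖ = √(z ^ 2 + (q.1 ^ 2 + q.2 ^ 2)) := by
    simp [EuclideanSpace.norm_eq, Fin.sum_univ_three, add_assoc]
  have hinner (z : ℝ) : ∫⁻ q : ℝ × ℝ, ENNReal.ofReal
      (exp (-(a * ‖(!₂[z, q.1, q.2] : EuclideanSpace ℝ (Fin 3))‖ -
        c * (!₂[z, q.1, q.2] : EuclideanSpace ℝ (Fin 3)) 0)) /
        ‖(!₂[z, q.1, q.2] : EuclideanSpace ℝ (Fin 3))‖) =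
      ENNReal.ofReal (2 * π / a) * ENNReal.ofReal (exp (c * z - a * |z|)) := by
    simp_rw [hnorm]
    rw [← ENNReal.ofReal_mul (by positivity),
      show 2 * π / a * exp (c * z - a * |z|) = exp (c * z) * (2 * π / a * exp (-a * |z|)) by
        rw [sub_eq_add_neg, exp_add]; ring_nf,
      ENNReal.ofReal_mul (exp_pos _).le, ← lintegral_plane_exp_neg_mul_sqrt ha,
      ← lintegral_const_mul _ (by fun_prop)]
    refine lintegral_congr fun q ↦ ?_
    rw [← ENNReal.ofReal_mul (exp_pos _).le, ← mul_div_assoc, ← exp_add]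
    simp
    ring_nf
  simp_rw [hinner]
  rw [lintegral_const_mul _ (by fun_prop), lintegral_exp_mul_sub_mul_abs h,
    ← ENNReal.ofReal_mul (by positivity)]
  congr 1
  field_simp
  ring

lemma lintegral_lightCone_exp {a : ℝ} {b : EuclideanSpace ℝ (Fin 3)} (h : ‖b‖ < a) :
    ∫⁻ p : EuclideanSpace ℝ (Fin 3), ENNReal.ofReal (exp (-(a * ‖p‖ - inner ℝ b p)) / ‖p‖) =
      ENNReal.ofReal (4 * π / (a ^ 2 - ‖b‖ ^ 2)) := by
  set v : EuclideanSpace ℝ (Fin 3) := EuclideanSpace.single 0 ‖b‖ with hv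
  have hbv : ‖v‖ = ‖b‖ := by simp [hv]
  set R := (Submodule.span ℝ {v - b})ᗮ.reflection
  have hR : R v = b := Submodule.reflection_sub hbv
  rw [← lintegral_lightCone_exp_axis (c := ‖b‖) (by simpa using h),
    ← R.measurePreserving.lintegral_comp (by fun_prop)]
  refine lintegral_congr fun p ↦ ?_
  have : inner ℝ b (R p) = ‖b‖ * p 0 := by
    rw [← hR, R.inner_map_map, hR, hv, EuclideanSpace.inner_single_left]
    simp
  rw [this, R.norm_map]

lemma mem_forwardCone_iff_norm {β : Fin 4 → ℝ} :
    β ∈ forwardCone ↔ ‖(!₂[β 1, β 2, β 3] : EuclideanSpace ℝ (Fin 3))‖ < β 0 := by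
  simp [forwardCone, EuclideanSpace.norm_eq, Fin.sum_univ_three]

lemma isOpen_forwardCone : IsOpen forwardCone :=
  isOpen_lt (by fun_prop) (by fun_prop)

lemma smul_mem_forwardCone {β : Fin 4 → ℝ} (hβ : β ∈ forwardCone) {c : ℝ} (hc : 0 < c) :
    c • β ∈ forwardCone := by
  rw [mem_forwardCone_iff_norm] at hβ ⊢
  have : (!₂[(c • β) 1, (c • β) 2, (c • β) 3] : EuclideanSpace ℝ (Fin 3)) =
      c • !₂[β 1, β 2, β 3] := by
    ext i; fin_cases i <;> simp
  rw [this, norm_smul, Real.norm_of_nonneg hc.le]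
  exact mul_lt_mul_of_pos_left hβ hc

lemma minkowski_self_eq_sub_norm_sq (β : Fin 4 → ℝ) :
    minkowski β β = β 0 ^ 2 - ‖(!₂[β 1, β 2, β 3] : EuclideanSpace ℝ (Fin 3))‖ ^ 2 := by
  simp [minkowski, EuclideanSpace.norm_sq_eq, Fin.sum_univ_three]
  ring

lemma minkowski_self_pos {β : Fin 4 → ℝ} (hβ : β ∈ forwardCone) : 0 < minkowski β β := by
  rw [minkowski_self_eq_sub_norm_sq, sub_pos]
  exact pow_lt_pow_left₀ (mem_forwardCone_iff_norm.1 hβ) (norm_nonneg _) two_ne_zero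

lemma minkowski_onShell (β : Fin 4 → ℝ) (p : EuclideanSpace ℝ (Fin 3)) :
    minkowski β (onShell p) = β 0 * ‖p‖ - inner ℝ !₂[β 1, β 2, β 3] p := by
  simp [minkowski, onShell, PiLp.inner_apply, Fin.sum_univ_three]
  ring

lemma minkowski_onShell_pos {β : Fin 4 → ℝ} (hβ : β ∈ forwardCone)
    {p : EuclideanSpace ℝ (Fin 3)} (hp : p ≠ 0) : 0 < minkowski β (onShell p) := by
  rw [minkowski_onShell, sub_pos]
  exact (real_inner_le_norm _ _).trans_lt
    (mul_lt_mul_of_pos_right (mem_forwardCone_iff_norm.1 hβ) (norm_pos_iff.2 hp))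

lemma minkowski_add_left (x y z : Fin 4 → ℝ) :
    minkowski (x + y) z = minkowski x z + minkowski y z := by
  simp [minkowski]; ring

lemma minkowski_smul_left (c : ℝ) (x y : Fin 4 → ℝ) :
    minkowski (c • x) y = c * minkowski x y := by
  simp [minkowski]; ring

lemma minkowski_comm (x y : Fin 4 → ℝ) : minkowski x y = minkowski y x := by
  simp [minkowski]; ring

lemma minkowski_metric_left (μ : Fin 4) (x : Fin 4 → ℝ) :
    minkowski (minkowskiMetric μ) x = x μ := by
  fin_cases μ <;> simp [minkowski, minkowskiMetric]

@[fun_prop]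
lemma continuous_minkowski_onShell (β : Fin 4 → ℝ) :
    Continuous fun p ↦ minkowski β (onShell p) := by
  simp_rw [minkowski_onShell]
  fun_prop

@[fun_prop]
lemma measurable_minkowski_onShell (β : Fin 4 → ℝ) :
    Measurable fun p ↦ minkowski β (onShell p) :=
  (continuous_minkowski_onShell β).measurable

lemma lintegral_exp_neg_minkowski {β : Fin 4 → ℝ} (hβ : β ∈ forwardCone) :
    ∫⁻ p, ENNReal.ofReal (exp (-minkowski β (onShell p)) / ‖p‖) =
      ENNReal.ofReal (4 * π / minkowski β β) := by
  simp_rw [minkowski_onShell]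
  rw [lintegral_lightCone_exp (mem_forwardCone_iff_norm.1 hβ), minkowski_self_eq_sub_norm_sq]

/-- The measure on momentum space with density `exp (-η(β, P(p))) / ‖p‖`. -/
noncomputable def lightConeMeasure (β : Fin 4 → ℝ) : Measure (EuclideanSpace ℝ (Fin 3)) :=
  volume.withDensity fun p ↦ ENNReal.ofReal (exp (-minkowski β (onShell p)) / ‖p‖)

lemma integrable_lightConeMeasure_iff {β : Fin 4 → ℝ} {f : EuclideanSpace ℝ (Fin 3) → ℝ} :
    Integrable f (lightConeMeasure β) ↔
      Integrable fun p ↦ f p * (exp (-minkowski β (onShell p)) / ‖p‖) := by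
  rw [lightConeMeasure, integrable_withDensity_iff (by fun_prop) (by simp)]
  refine integrable_congr (ae_of_all _ fun p ↦ ?_)
  simp only
  rw [ENNReal.toReal_ofReal (by positivity)]

lemma integral_lightConeMeasure (β : Fin 4 → ℝ) (f : EuclideanSpace ℝ (Fin 3) → ℝ) :
    ∫ p, f p ∂lightConeMeasure β = ∫ p, f p * (exp (-minkowski β (onShell p)) / ‖p‖) := by
  rw [lightConeMeasure, integral_withDensity_eq_integral_toReal_smul (by fun_prop) (by simp)]
  refine integral_congr_ae (ae_of_all _ fun p ↦ ?_)
  simp only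
  rw [ENNReal.toReal_ofReal (by positivity), smul_eq_mul, mul_comm]

lemma mgf_lightConeMeasure {β v : Fin 4 → ℝ} {t : ℝ} (h : β + t • v ∈ forwardCone) :
    mgf (fun p ↦ -minkowski v (onShell p)) (lightConeMeasure β) t =
      4 * π / minkowski (β + t • v) (β + t • v) := by
  have hpos := minkowski_self_pos h
  rw [mgf, integral_lightConeMeasure, ← ENNReal.toReal_ofReal (r := 4 * π / _) (by positivity),
    ← lintegral_exp_neg_minkowski h, integral_eq_lintegral_of_nonneg_ae
      (ae_of_all _ fun p ↦ by positivity) (Measurable.aestronglyMeasurable (by fun_prop))]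
  congr 1
  refine lintegral_congr fun p ↦ ?_
  rw [← mul_div_assoc, ← exp_add, minkowski_add_left, minkowski_smul_left]
  ring_nf

lemma eventually_add_smul_mem_forwardCone {β : Fin 4 → ℝ} (hβ : β ∈ forwardCone)
    (v : Fin 4 → ℝ) : ∀ᶠ t : ℝ in 𝓝 0, β + t • v ∈ forwardCone := by
  have hcont : Continuous fun t : ℝ ↦ β + t • v := by fun_prop
  exact hcont.continuousAt.eventually_mem (isOpen_forwardCone.mem_nhds (by simpa using hβ))

lemma zero_mem_interior_integrableExpSet {β : Fin 4 → ℝ} (hβ : β ∈ forwardCone)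
    (v : Fin 4 → ℝ) : 0 ∈ interior
      (integrableExpSet (fun p ↦ -minkowski v (onShell p)) (lightConeMeasure β)) := by
  rw [mem_interior_iff_mem_nhds]
  filter_upwards [eventually_add_smul_mem_forwardCone hβ v] with t ht
  refine Integrable.of_integral_ne_zero ?_
  change mgf _ _ _ ≠ 0
  rw [mgf_lightConeMeasure ht]
  have := minkowski_self_pos ht
  positivity

lemma iteratedDeriv_two_const_div_quadratic {A : ℝ} (hA : A ≠ 0) (K B C : ℝ) :
    iteratedDeriv 2 (fun t ↦ K / (A + B * t + C * t ^ 2)) 0 =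
      K * (2 * B ^ 2 / A ^ 3 - 2 * C / A ^ 2) := by
  have hq (t : ℝ) : HasDerivAt (fun t ↦ A + B * t + C * t ^ 2) (B + 2 * C * t) t := by
    have h := (((hasDerivAt_id t).const_mul B).const_add A).add ((hasDerivAt_pow 2 t).const_mul C)
    refine h.congr_deriv ?_
    simp
    ring
  have hne : ∀ᶠ t : ℝ in 𝓝 0, A + B * t + C * t ^ 2 ≠ 0 :=
    (hq 0).continuousAt.eventually_ne (by simpa using hA)
  have hderiv : deriv (fun t ↦ K / (A + B * t + C * t ^ 2)) =ᶠ[𝓝 0]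
      fun t ↦ -(K * (B + 2 * C * t)) / (A + B * t + C * t ^ 2) ^ 2 := by
    filter_upwards [hne] with t ht
    refine (((hasDerivAt_const t K).div (hq t) ht).congr_deriv ?_).deriv
    ring
  rw [iteratedDeriv_succ, iteratedDeriv_one, hderiv.deriv_eq]
  have hnum : HasDerivAt (fun t ↦ -(K * (B + 2 * C * t))) (-(K * (2 * C))) 0 := by
    have h := ((((hasDerivAt_id (0 : ℝ)).const_mul (2 * C)).const_add B).const_mul K).neg
    refine h.congr_deriv ?_
    simp
  refine ((hnum.div ((hq 0).pow 2) (by simpa using hA)).congr_deriv ?_).deriv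
  simp
  field_simp
  ring

lemma integrable_minkowski_sq_mul_exp {β : Fin 4 → ℝ} (hβ : β ∈ forwardCone) (v : Fin 4 → ℝ) :
    Integrable fun p ↦ minkowski v (onShell p) ^ 2 *
      (exp (-minkowski β (onShell p)) / ‖p‖) := by
  rw [← integrable_lightConeMeasure_iff]
  simpa using integrable_pow_of_mem_interior_integrableExpSet
    (zero_mem_interior_integrableExpSet hβ v) 2

lemma integral_minkowski_sq_mul_exp {β : Fin 4 → ℝ} (hβ : β ∈ forwardCone) (v : Fin 4 → ℝ) :
    ∫ p, minkowski v (onShell p) ^ 2 * (exp (-minkowski β (onShell p)) / ‖p‖) =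
      8 * π * (4 * minkowski v β ^ 2 - minkowski β β * minkowski v v) / minkowski β β ^ 3 := by
  have hpos := minkowski_self_pos hβ
  have hmgf : mgf (fun p ↦ -minkowski v (onShell p)) (lightConeMeasure β) =ᶠ[𝓝 0]
      fun t ↦ 4 * π / (minkowski β β + 2 * minkowski v β * t + minkowski v v * t ^ 2) := by
    filter_upwards [eventually_add_smul_mem_forwardCone hβ v] with t ht
    rw [mgf_lightConeMeasure ht]
    congr 1
    simp [minkowski]
    ring
  have hmoment := iteratedDeriv_mgf_zero (zero_mem_interior_integrableExpSet hβ v) 2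
  rw [hmgf.iteratedDeriv_eq, iteratedDeriv_two_const_div_quadratic hpos.ne'] at hmoment
  simp only [Pi.pow_apply, neg_sq] at hmoment
  rw [← integral_lightConeMeasure, ← hmoment]
  field_simp
  ring

lemma minkowski_mul_onShell_polarization (v w : Fin 4 → ℝ) (p : EuclideanSpace ℝ (Fin 3))
    (c : ℝ) : minkowski v (onShell p) * minkowski w (onShell p) * c =
      (1 / 4) * (minkowski (v + w) (onShell p) ^ 2 * c) -
        (1 / 4) * (minkowski (v + (-1 : ℝ) • w) (onShell p) ^ 2 * c) := by
  simp only [minkowski_add_left, minkowski_smul_left]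
  ring

lemma integrable_minkowski_mul_minkowski_mul_exp {β : Fin 4 → ℝ} (hβ : β ∈ forwardCone)
    (v w : Fin 4 → ℝ) :
    Integrable fun p ↦ minkowski v (onShell p) * minkowski w (onShell p) *
      (exp (-minkowski β (onShell p)) / ‖p‖) := by
  simp_rw [minkowski_mul_onShell_polarization]
  exact ((integrable_minkowski_sq_mul_exp hβ _).const_mul _).sub
    ((integrable_minkowski_sq_mul_exp hβ _).const_mul _)

lemma integral_minkowski_mul_minkowski_mul_exp {β : Fin 4 → ℝ} (hβ : β ∈ forwardCone)
    (v w : Fin 4 → ℝ) :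
    ∫ p, minkowski v (onShell p) * minkowski w (onShell p) *
      (exp (-minkowski β (onShell p)) / ‖p‖) =
      8 * π * (4 * minkowski v β * minkowski w β - minkowski β β * minkowski v w) /
        minkowski β β ^ 3 := by
  simp_rw [minkowski_mul_onShell_polarization]
  rw [integral_sub ((integrable_minkowski_sq_mul_exp hβ _).const_mul _)
    ((integrable_minkowski_sq_mul_exp hβ _).const_mul _), integral_const_mul, integral_const_mul,
    integral_minkowski_sq_mul_exp hβ, integral_minkowski_sq_mul_exp hβ]
  have hexpand (c : ℝ) : minkowski (v + c • w) (v + c • w) =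
      minkowski v v + 2 * c * minkowski v w + c ^ 2 * minkowski w w := by
    simp [minkowski]
    ring
  have hexpand_one : minkowski (v + w) (v + w) =
      minkowski v v + 2 * minkowski v w + minkowski w w := by
    simpa using hexpand 1
  rw [hexpand, hexpand_one]
  simp only [minkowski_add_left, minkowski_smul_left]
  ring

lemma hasSum_exp_neg_succ_mul {x : ℝ} (hx : 0 < x) :
    HasSum (fun n : ℕ ↦ exp (-((n + 1 : ℝ) * x))) (exp x - 1)⁻¹ := by
  have h := (hasSum_geometric_of_lt_one (exp_pos (-x)).le
    (exp_lt_one_iff.2 (neg_lt_zero.2 hx))).mul_left (exp (-x))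
  have h₁ : 1 < exp x := one_lt_exp_iff.2 hx
  have h₂ : exp x - 1 ≠ 0 := by linarith
  convert! h using 1
  · ext n
    rw [← exp_nat_mul, ← exp_add]
    ring_nf
  · have h₃ : 1 - (exp x)⁻¹ ≠ 0 := by
      rw [sub_ne_zero]
      exact (inv_lt_one_of_one_lt₀ h₁).ne'
    rw [exp_neg]
    field_simp

lemma hasSum_boseEinstein {β : Fin 4 → ℝ} (hβ : β ∈ forwardCone) (μ ν : Fin 4)
    (p : EuclideanSpace ℝ (Fin 3)) :
    HasSum (fun n : ℕ ↦ onShell p μ * onShell p ν *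
      (exp (-minkowski ((n + 1 : ℝ) • β) (onShell p)) / ‖p‖))
      (onShell p μ * onShell p ν / ‖p‖ * (exp (minkowski β (onShell p)) - 1)⁻¹) := by
  rcases eq_or_ne p 0 with rfl | hp
  · simp
  convert! (hasSum_exp_neg_succ_mul (minkowski_onShell_pos hβ hp)).mul_left
    (onShell p μ * onShell p ν / ‖p‖) using 2 with n
  rw [minkowski_smul_left]
  ring

lemma integrable_onShell_mul_exp {β : Fin 4 → ℝ} (hβ : β ∈ forwardCone) (μ ν : Fin 4) :
    Integrable fun p ↦ onShell p μ * onShell p ν *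
      (exp (-minkowski β (onShell p)) / ‖p‖) := by
  simpa only [minkowski_metric_left] using
    integrable_minkowski_mul_minkowski_mul_exp hβ (minkowskiMetric μ) (minkowskiMetric ν)

lemma integral_onShell_mul_exp_smul {β : Fin 4 → ℝ} (hβ : β ∈ forwardCone) (μ ν : Fin 4)
    {c : ℝ} (hc : 0 < c) :
    ∫ p, onShell p μ * onShell p ν * (exp (-minkowski (c • β) (onShell p)) / ‖p‖) =
      8 * π * (4 * β μ * β ν - minkowski β β * minkowskiMetric μ ν) / minkowski β β ^ 3 *
        (1 / c ^ 4) := by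
  have hpos := minkowski_self_pos hβ
  have h := integral_minkowski_mul_minkowski_mul_exp (smul_mem_forwardCone hβ hc)
    (minkowskiMetric μ) (minkowskiMetric ν)
  simp only [minkowski_metric_left] at h
  rw [h, minkowski_smul_left, minkowski_comm β, minkowski_smul_left]
  have hsymm : minkowskiMetric ν μ = minkowskiMetric μ ν := by
    by_cases hμν : μ = ν
    · rw [hμν]
    · simp [minkowskiMetric, hμν, Ne.symm hμν]
  simp only [Pi.smul_apply, smul_eq_mul, hsymm]
  field_simp

lemma abs_onShell_le (p : EuclideanSpace ℝ (Fin 3)) (μ : Fin 4) : |onShell p μ| ≤ ‖p‖ := by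
  fin_cases μ
  · simp [onShell]
  · exact PiLp.norm_apply_le p 0
  · exact PiLp.norm_apply_le p 1
  · exact PiLp.norm_apply_le p 2

lemma hasSum_zeta_four_succ : HasSum (fun n : ℕ ↦ 1 / (n + 1 : ℝ) ^ 4) (π ^ 4 / 90) := by
  have h := (hasSum_nat_add_iff' 1).2 hasSum_zeta_four
  simpa using h

lemma abs_onShell_mul_le (p : EuclideanSpace ℝ (Fin 3)) (μ ν : Fin 4) :
    |onShell p μ * onShell p ν| ≤ onShell p 0 * onShell p 0 := by
  rw [abs_mul]
  exact mul_le_mul (abs_onShell_le p μ) (abs_onShell_le p ν) (abs_nonneg _) (norm_nonneg p)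

lemma summable_integral_norm_onShell_mul_exp {β : Fin 4 → ℝ} (hβ : β ∈ forwardCone)
    (μ ν : Fin 4) :
    Summable fun n : ℕ ↦ ∫ p, ‖onShell p μ * onShell p ν *
      (exp (-minkowski ((n + 1 : ℝ) • β) (onShell p)) / ‖p‖)‖ := by
  refine Summable.of_nonneg_of_le (fun n ↦ integral_nonneg fun p ↦ norm_nonneg _) (fun n ↦ ?_)
    (hasSum_zeta_four_succ.summable.mul_left
      (8 * π * (4 * β 0 * β 0 - minkowski β β * minkowskiMetric 0 0) / minkowski β β ^ 3))
  rw [← integral_onShell_mul_exp_smul hβ 0 0 n.cast_add_one_pos]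
  have hmem := smul_mem_forwardCone hβ (n.cast_add_one_pos (α := ℝ))
  refine integral_mono (integrable_onShell_mul_exp hmem μ ν).norm
    (integrable_onShell_mul_exp hmem 0 0) fun p ↦ ?_
  simp only
  rw [norm_mul, Real.norm_of_nonneg (r := _ / _) (by positivity)]
  exact mul_le_mul_of_nonneg_right (abs_onShell_mul_le p μ ν) (by positivity)

lemma integral_boseEinstein {β : Fin 4 → ℝ} (hβ : β ∈ forwardCone) (μ ν : Fin 4) :
    ∫ p, onShell p μ * onShell p ν / ‖p‖ * (exp (minkowski β (onShell p)) - 1)⁻¹ =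
      8 * π * (4 * β μ * β ν - minkowski β β * minkowskiMetric μ ν) / minkowski β β ^ 3 *
        (π ^ 4 / 90) := by
  have h := hasSum_integral_of_summable_integral_norm
    (fun n : ℕ ↦ integrable_onShell_mul_exp
      (smul_mem_forwardCone hβ (n.cast_add_one_pos (α := ℝ))) μ ν)
    (summable_integral_norm_onShell_mul_exp hβ μ ν)
  simp_rw [(hasSum_boseEinstein hβ μ ν _).tsum_eq,
    integral_onShell_mul_exp_smul hβ μ ν (Nat.cast_add_one_pos _)] at h
  exact h.unique (hasSum_zeta_four_succ.mul_left _)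

lemma integrable_boseEinstein {β : Fin 4 → ℝ} (hβ : β ∈ forwardCone) (μ ν : Fin 4) :
    Integrable fun p ↦ onShell p μ * onShell p ν / ‖p‖ *
      (exp (minkowski β (onShell p)) - 1)⁻¹ := by
  have henergy : Integrable fun p ↦ onShell p 0 * onShell p 0 / ‖p‖ *
      (exp (minkowski β (onShell p)) - 1)⁻¹ := by
    refine Integrable.of_integral_ne_zero ?_
    have hpos := minkowski_self_pos hβ
    have hnum : 0 < 4 * β 0 * β 0 - minkowski β β * minkowskiMetric 0 0 := by
      simp only [minkowskiMetric, if_true]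
      simp only [minkowski] at hpos ⊢
      nlinarith [sq_nonneg (β 1), sq_nonneg (β 2), sq_nonneg (β 3)]
    rw [integral_boseEinstein hβ]
    positivity
  have hmeas (κ : Fin 4) : Measurable fun p ↦ onShell p κ := by
    simp_rw [← minkowski_metric_left κ (onShell _)]
    exact measurable_minkowski_onShell _
  refine henergy.mono (Measurable.aestronglyMeasurable (by fun_prop)) (ae_of_all _ fun p ↦ ?_)
  rw [norm_mul, norm_mul, norm_div, norm_div]
  gcongr
  exact (abs_onShell_mul_le p μ ν).trans (le_abs_self _)

/-- Lorentz-covariant formula for the thermal stress-energy tensor of the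
    massless Klein–Gordon field:
    E_{μν}(𝛃) = (2π)⁻³ ∫_{ℝ³} (P(p)_μ P(p)_ν/‖p‖)(e^{η(𝛃,P(p))} − 1)⁻¹ dp
              = (π²/90)(4𝛃_μ𝛃_ν − 𝛃² g_{μν})(𝛃²)⁻³. -/
theorem thermal_stress_energy_covariant
    (β : Fin 4 → ℝ) (hβ : β ∈ forwardCone) (μ ν : Fin 4) :
    Integrable (fun p : EuclideanSpace ℝ (Fin 3) =>
      (onShell p μ * onShell p ν / ‖p‖) *
        (Real.exp (minkowski β (onShell p)) - 1)⁻¹) ∧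
    ((2 * Real.pi) ^ 3)⁻¹ *
      (∫ p : EuclideanSpace ℝ (Fin 3),
        (onShell p μ * onShell p ν / ‖p‖) *
          (Real.exp (minkowski β (onShell p)) - 1)⁻¹) =
      (Real.pi ^ 2 / 90) *
        (4 * β μ * β ν - minkowski β β * minkowskiMetric μ ν) *
        (minkowski β β ^ 3)⁻¹ := by
  refine ⟨integrable_boseEinstein hβ μ ν, ?_⟩
  have hpos := minkowski_self_pos hβ
  rw [integral_boseEinstein hβ]
  field_simp
  ring
end

section
/- Let β > 0 and let z ∈ ℂ with 0 < Im z < β. Then (1/(4π²)) ∫₀^∞ ω ( e^{iωz} + e^{−iωz} e^{−βω} ) (1 − e^{−βω})⁻¹ dω = −1/(4β² sinh²(πz/β)). (Closed form of the analytically continued two-point function of the massless free field in the β-KMS state along the time axis; it is holomorphic on the strip S_β, manifestly satisfies the KMS reflection z ↦ iβ − z, and tends to 0 as |Re z| → ∞, verifying the analyticity, periodicity and clustering properties of the KMS/LKMS condition.) -/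
open MeasureTheory Real Complex

lemma integrableOn_id_mul_rexp_neg_mul {b : ℝ} (hb : 0 < b) :
    IntegrableOn (fun ω : ℝ => ω * Real.exp (-b * ω)) (Set.Ioi 0) := by
  simpa using integrableOn_rpow_mul_exp_neg_mul_rpow (p := 1) (s := 1) (by norm_num) one_pos hb

lemma integral_id_mul_rexp_neg_mul {b : ℝ} (hb : 0 < b) :
    ∫ ω in Set.Ioi (0 : ℝ), ω * Real.exp (-b * ω) = 1 / b ^ 2 := by
  have h := Real.integral_rpow_mul_exp_neg_mul_Ioi (a := 2) (by norm_num) hb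
  norm_num at h
  simpa [neg_mul] using h

lemma norm_ofReal_mul_cexp_neg_mul {a : ℂ} {ω : ℝ} (hω : 0 ≤ ω) :
    ‖(ω : ℂ) * Complex.exp (-a * ω)‖ = ω * Real.exp (-a.re * ω) := by
  simp [Complex.norm_exp, abs_of_nonneg hω]

lemma integrableOn_id_mul_cexp_neg_mul {a : ℂ} (ha : 0 < a.re) :
    IntegrableOn (fun ω : ℝ => (ω : ℂ) * Complex.exp (-a * ω)) (Set.Ioi 0) := by
  refine (integrableOn_id_mul_rexp_neg_mul ha).mono' (by fun_prop) ?_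
  filter_upwards [ae_restrict_mem measurableSet_Ioi] with ω hω
  exact (norm_ofReal_mul_cexp_neg_mul (le_of_lt hω)).le

lemma integral_norm_id_mul_cexp_neg_mul {a : ℂ} (ha : 0 < a.re) :
    ∫ ω in Set.Ioi (0 : ℝ), ‖(ω : ℂ) * Complex.exp (-a * ω)‖ = 1 / a.re ^ 2 := by
  rw [← integral_id_mul_rexp_neg_mul ha]
  exact setIntegral_congr_fun measurableSet_Ioi fun ω hω =>
    norm_ofReal_mul_cexp_neg_mul (le_of_lt (Set.mem_Ioi.1 hω))

lemma integral_id_mul_cexp_neg_mul {a : ℂ} (ha : 0 < a.re) :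
    ∫ ω in Set.Ioi (0 : ℝ), (ω : ℂ) * Complex.exp (-a * ω) = 1 / a ^ 2 := by
  have ha0 : a ≠ 0 := by rintro rfl; simp at ha
  have hderiv (x : ℝ) : HasDerivAt
      (fun ω : ℝ => -(1 / a) * ((ω : ℂ) * Complex.exp (-a * ω)) -
        1 / a ^ 2 * Complex.exp (-a * ω)) ((x : ℂ) * Complex.exp (-a * x)) x := by
    have hx := (hasDerivAt_id x).ofReal_comp
    have he := (hx.const_mul (-a)).cexp
    refine (((hx.fun_mul he).const_mul (-(1 / a))).fun_sub
      (he.const_mul (1 / a ^ 2))).congr_deriv ?_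
    simp only [ofReal_one, id]
    field_simp
    ring
  have hlim : Filter.Tendsto (fun ω : ℝ => -(1 / a) * ((ω : ℂ) * Complex.exp (-a * ω)) -
      1 / a ^ 2 * Complex.exp (-a * ω)) Filter.atTop (nhds 0) := by
    have h1 : Filter.Tendsto (fun ω : ℝ => (ω : ℂ) * Complex.exp (-a * ω))
        Filter.atTop (nhds 0) := by
      rw [tendsto_zero_iff_norm_tendsto_zero]
      refine (tendsto_rpow_mul_exp_neg_mul_atTop_nhds_zero 1 _ ha).congr' ?_
      filter_upwards [Filter.eventually_ge_atTop 0] with ω hω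
      rw [norm_ofReal_mul_cexp_neg_mul hω, Real.rpow_one]
    have h2 : Filter.Tendsto (fun ω : ℝ => Complex.exp (-a * ω)) Filter.atTop (nhds 0) := by
      rw [tendsto_zero_iff_norm_tendsto_zero]
      refine (tendsto_rpow_mul_exp_neg_mul_atTop_nhds_zero 0 _ ha).congr fun ω => ?_
      simp [Complex.norm_exp]
    have h := (h1.const_mul (-(1 / a))).sub (h2.const_mul (1 / a ^ 2))
    rwa [mul_zero, mul_zero, sub_zero] at h
  rw [integral_Ioi_of_hasDerivAt_of_tendsto' (fun x _ => hderiv x)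
    (integrableOn_id_mul_cexp_neg_mul ha) hlim]
  simp

lemma summable_one_div_add_natCast_mul_sq {x β : ℝ} (hx : 0 < x) (hβ : 0 < β) :
    Summable fun n : ℕ => 1 / (x + n * β) ^ 2 := by
  rw [← summable_nat_add_iff 1]
  have h : Summable fun n : ℕ => (1 / β ^ 2) * (1 / ((n + 1 : ℕ) : ℝ) ^ 2) :=
    ((summable_nat_add_iff 1).2 (Real.summable_one_div_nat_pow.2 one_lt_two)).mul_left _
  refine h.of_nonneg_of_le (fun n => by positivity) fun n => ?_
  rw [one_div_mul_one_div, ← mul_pow]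
  apply one_div_le_one_div_of_le (by positivity)
  gcongr
  nlinarith

/-- The integrand with a Bose factor is absolutely integrable. -/
lemma integrableOn_id_mul_cexp_mul_bose {a : ℂ} {β : ℝ} (ha : 0 < a.re) (hβ : 0 < β) :
    IntegrableOn (fun ω : ℝ => (ω : ℂ) * Complex.exp (-a * ω) *
      (1 - (Real.exp (-β * ω) : ℂ))⁻¹) (Set.Ioi 0) := by
  have hexp : IntegrableOn (fun ω : ℝ => Real.exp (-a.re * ω)) (Set.Ioi 0) :=
    integrableOn_exp_mul_Ioi (by linarith) 0
  refine ((hexp.const_mul (1 / β)).add (integrableOn_id_mul_rexp_neg_mul ha)).mono'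
    (Measurable.aestronglyMeasurable (by fun_prop)) ?_
  filter_upwards [ae_restrict_mem measurableSet_Ioi] with ω hω
  have hω : 0 < ω := hω
  have h1 : Real.exp (-β * ω) < 1 := by
    rw [Real.exp_lt_one_iff]; nlinarith
  rw [norm_mul, norm_ofReal_mul_cexp_neg_mul hω.le, norm_inv, ← ofReal_one, ← ofReal_sub,
    Complex.norm_real, Real.norm_of_nonneg (by linarith), ← div_eq_mul_inv,
    div_le_iff₀ (by linarith)]
  have h2 : (1 + β * ω) * Real.exp (-β * ω) ≤ 1 := by
    have := Real.add_one_le_exp (β * ω)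
    calc _ ≤ Real.exp (β * ω) * Real.exp (-β * ω) := by gcongr; linarith
      _ = 1 := by rw [← Real.exp_add]; simp
  have h3 : ω ≤ (1 / β + ω) * (1 - Real.exp (-β * ω)) := by
    rw [show 1 / β + ω = (1 + β * ω) / β by field_simp, div_mul_eq_mul_div, le_div_iff₀ hβ]
    linarith
  have := mul_le_mul_of_nonneg_right h3 (Real.exp_pos (-a.re * ω)).le
  simp only [Pi.add_apply]
  linarith

lemma hasSum_integral_id_mul_cexp_mul_bose {a : ℂ} {β : ℝ} (ha : 0 < a.re) (hβ : 0 < β) :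
    HasSum (fun n : ℕ => 1 / (a + n * β) ^ 2)
      (∫ ω in Set.Ioi (0 : ℝ), (ω : ℂ) * Complex.exp (-a * ω) *
        (1 - (Real.exp (-β * ω) : ℂ))⁻¹) := by
  have hre (n : ℕ) : (a + n * β).re = a.re + n * β := by simp
  have hpos (n : ℕ) : 0 < (a + n * β).re := by rw [hre]; positivity
  have key := hasSum_integral_of_summable_integral_norm (μ := volume.restrict (Set.Ioi (0 : ℝ)))
    (F := fun (n : ℕ) (ω : ℝ) => (ω : ℂ) * Complex.exp (-(a + n * β) * ω))
    (fun n => integrableOn_id_mul_cexp_neg_mul (hpos n)) (by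
      refine (summable_one_div_add_natCast_mul_sq ha hβ).congr fun n => ?_
      rw [integral_norm_id_mul_cexp_neg_mul (hpos n), hre])
  simp only [integral_id_mul_cexp_neg_mul (hpos _)] at key
  rw [setIntegral_congr_fun (g := fun ω : ℝ => ∑' n : ℕ, (ω : ℂ) *
    Complex.exp (-(a + n * β) * ω)) measurableSet_Ioi fun ω hω => ?_]
  · exact key
  have hω : 0 < ω := hω
  have h1 : ‖(Real.exp (-β * ω) : ℂ)‖ < 1 := by
    rw [Complex.norm_real, Real.norm_of_nonneg (Real.exp_pos _).le, Real.exp_lt_one_iff]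
    nlinarith
  simp only [← tsum_geometric_of_norm_lt_one h1, ← tsum_mul_left]
  congr 1 with n
  rw [mul_assoc, ofReal_exp, ← Complex.exp_nat_mul, ← Complex.exp_add]
  push_cast
  ring_nf

lemma norm_neg_one_div_sq_le {δ : ℝ} (hδ : 0 < δ) (n : ℕ) {w : ℂ} (hw : δ * (n + 1) ≤ |w.re|) :
    ‖-(1 / w ^ 2)‖ ≤ 1 / δ ^ 2 * (1 / ((n + 1 : ℕ) : ℝ) ^ 2) := by
  rw [norm_neg, norm_div, norm_one, norm_pow, one_div_mul_one_div, ← mul_pow]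
  apply one_div_le_one_div_of_le (by positivity)
  gcongr
  push_cast
  exact hw.trans (abs_re_le_norm w)

/-- The term-by-term derivative of the Mittag-Leffler expansion of the cotangent. -/
lemma tsum_one_div_sq_eq_pi_sq_div_sin_sq {v : ℂ} (h0 : 0 < v.re) (h1 : v.re < 1) :
    ∑' n : ℕ, (1 / (v - (n + 1)) ^ 2 + 1 / (v + (n + 1)) ^ 2) =
      π ^ 2 / Complex.sin (π * v) ^ 2 - 1 / v ^ 2 := by
  obtain ⟨δ, hδ, hδv⟩ := exists_between (lt_min h0 (sub_pos.2 h1))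
  rw [lt_min_iff] at hδv
  set t : Set ℂ := {w | w.re ∈ Set.Ioo δ (1 - δ)} with ht
  have hvt : v ∈ t := ⟨hδv.1, by linarith [hδv.2]⟩
  have hto : IsOpen t := isOpen_Ioo.preimage continuous_re
  have htp : IsPreconnected t :=
    ((convex_Ioo δ (1 - δ)).is_linear_preimage Complex.reCLM.isLinear).isPreconnected
  have hcompl {w : ℂ} (hw : w ∈ t) : w ∈ integerComplement := by
    rintro ⟨k, rfl⟩
    obtain ⟨h2, h3⟩ := hw
    simp only [intCast_re] at h2 h3
    have : (0 : ℤ) < k := by exact_mod_cast hδ.trans h2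
    have : k < (1 : ℤ) := by exact_mod_cast (by linarith : (k : ℝ) < 1)
    omega
  have hsub {w : ℂ} (hw : w ∈ t) (n : ℕ) : δ * (n + 1) ≤ |(w - (n + 1)).re| := by
    obtain ⟨h2, h3⟩ := hw
    simp only [sub_re, add_re, natCast_re, one_re]
    rw [abs_sub_comm]
    refine le_trans ?_ (le_abs_self _)
    nlinarith [(n.cast_nonneg : (0 : ℝ) ≤ n)]
  have hadd {w : ℂ} (hw : w ∈ t) (n : ℕ) : δ * (n + 1) ≤ |(w + (n + 1)).re| := by
    obtain ⟨h2, h3⟩ := hw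
    simp only [add_re, natCast_re, one_re]
    refine le_trans ?_ (le_abs_self _)
    nlinarith [(n.cast_nonneg : (0 : ℝ) ≤ n)]
  have hne {w : ℂ} {n : ℕ} (h : δ * (n + 1) ≤ |w.re|) : w ≠ 0 := by
    rintro rfl
    simp only [zero_re, abs_zero] at h
    have : 0 < δ * (n + 1) := by positivity
    linarith
  have hinv {w c : ℂ} (h : w + c ≠ 0) :
      HasDerivAt (fun x : ℂ => 1 / (x + c)) (-(1 / (w + c) ^ 2)) w := by
    simpa [neg_div] using ((hasDerivAt_id w).add_const c).fun_inv h
  have hu : Summable fun n : ℕ => 1 / δ ^ 2 * (1 / ((n + 1 : ℕ) : ℝ) ^ 2) :=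
    ((summable_nat_add_iff 1).2 (Real.summable_one_div_nat_pow.2 one_lt_two)).mul_left _
  have hseries := hasDerivAt_tsum_of_isPreconnected (hu.add hu) hto htp
    (g := fun n w => cotTerm w n)
    (g' := fun n w => -(1 / (w - (n + 1)) ^ 2) + -(1 / (w + (n + 1)) ^ 2))
    (fun n w hw => by
      refine .add ?_ (hinv (hne (hadd hw n)))
      simpa [sub_eq_add_neg] using hinv (w := w) (c := -(n + 1))
        (by simpa [sub_eq_add_neg] using hne (hsub hw n)))
    (fun n w hw => norm_add_le_of_le (norm_neg_one_div_sq_le hδ n (hsub hw n))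
      (norm_neg_one_div_sq_le hδ n (hadd hw n)))
    hvt (summable_cotTerm (hcompl hvt)) hvt
  have hsin : Complex.sin (π * v) ≠ 0 := sin_pi_mul_ne_zero (hcompl hvt)
  have hclosed : HasDerivAt (fun w : ℂ => π * Complex.cot (π * w) - 1 / w)
      (-(π ^ 2 / Complex.sin (π * v) ^ 2) + 1 / v ^ 2) v := by
    have hm : HasDerivAt (fun w : ℂ => π * w) π v := by
      simpa using (hasDerivAt_id v).const_mul (π : ℂ)
    have hv : v ≠ 0 := by rintro rfl; simp at h0
    have hi : HasDerivAt (fun x : ℂ => 1 / x) (-(1 / v ^ 2)) v := by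
      simpa using hinv (w := v) (c := 0) (by simpa using hv)
    simp only [Complex.cot]
    refine (((hm.ccos.fun_div hm.csin hsin).const_mul (π : ℂ)).fun_sub hi).congr_deriv ?_
    have := Complex.sin_sq_add_cos_sq (π * v)
    field_simp
    linear_combination -(π : ℂ) ^ 2 * v ^ 2 * this
  have heq := (hclosed.congr_of_eventuallyEq (f₁ := fun w => ∑' n, cotTerm w n) (by
    filter_upwards [hto.mem_nhds hvt] with w hw
    exact (cot_series_rep' (hcompl hw)).symm)).unique hseries
  simp only [← neg_add, tsum_neg] at heq
  linear_combination heq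

lemma hasSum_one_div_sq_eq {v S T : ℂ} (h0 : 0 < v.re) (h1 : v.re < 1)
    (hS : HasSum (fun n : ℕ => 1 / (v + n) ^ 2) S)
    (hT : HasSum (fun n : ℕ => 1 / (1 - v + n) ^ 2) T) :
    S + T = π ^ 2 / Complex.sin (π * v) ^ 2 := by
  have hS' := (hasSum_nat_add_iff' 1).2 hS
  have h := (hT.add hS').tsum_eq
  have := tsum_one_div_sq_eq_pi_sq_div_sin_sq h0 h1
  rw [← tsum_congr fun n : ℕ => ?_, h] at this
  · simp at this
    linear_combination this
  · push_cast
    congr 2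
    ring

/-- Closed form of the analytically continued two-point function of the
    massless free field in the β-KMS state along the time axis:
    (1/(4π²)) ∫₀^∞ ω (e^{iωz} + e^{−iωz}e^{−βω})(1 − e^{−βω})⁻¹ dω
      = −1/(4β² sinh²(πz/β)) for 0 < Im z < β. -/
theorem massless_thermal_closed_form (β : ℝ) (hβ : 0 < β) (z : ℂ)
    (h1 : 0 < z.im) (h2 : z.im < β) :
    IntegrableOn (fun ω : ℝ => (ω : ℂ) *
        (Complex.exp (Complex.I * (ω : ℂ) * z) +
          Complex.exp (-(Complex.I * (ω : ℂ) * z)) * (Real.exp (-β * ω) : ℂ)) *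
        (1 - (Real.exp (-β * ω) : ℂ))⁻¹) (Set.Ioi 0) ∧
    (1 / (4 * (Real.pi : ℂ) ^ 2)) *
        ∫ ω in Set.Ioi (0 : ℝ), (ω : ℂ) *
          (Complex.exp (Complex.I * (ω : ℂ) * z) +
            Complex.exp (-(Complex.I * (ω : ℂ) * z)) * (Real.exp (-β * ω) : ℂ)) *
          (1 - (Real.exp (-β * ω) : ℂ))⁻¹ =
      -(1 / (4 * (β : ℂ) ^ 2 * Complex.sinh ((Real.pi : ℂ) * z / (β : ℂ)) ^ 2)) := by
  have ha : 0 < (-(I * z)).re := by simpa using h1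
  have hb : 0 < (β + I * z).re := by simpa using h2
  have hsplit (ω : ℝ) : (ω : ℂ) * (Complex.exp (I * ω * z) +
        Complex.exp (-(I * ω * z)) * (Real.exp (-β * ω) : ℂ)) * (1 - (Real.exp (-β * ω) : ℂ))⁻¹ =
      (ω : ℂ) * Complex.exp (-(-(I * z)) * ω) * (1 - (Real.exp (-β * ω) : ℂ))⁻¹ +
      (ω : ℂ) * Complex.exp (-(β + I * z) * ω) * (1 - (Real.exp (-β * ω) : ℂ))⁻¹ := by
    rw [show -(-(I * z)) * (ω : ℂ) = I * ω * z by ring,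
      show -(β + I * z) * (ω : ℂ) = -(I * ω * z) + ((-β * ω : ℝ) : ℂ) by push_cast; ring,
      Complex.exp_add, ofReal_exp]
    ring
  have ia := integrableOn_id_mul_cexp_mul_bose ha hβ
  have ib := integrableOn_id_mul_cexp_mul_bose hb hβ
  simp only [hsplit]
  refine ⟨ia.add ib, ?_⟩
  rw [integral_add ia ib]
  have sa := (hasSum_integral_id_mul_cexp_mul_bose ha hβ).mul_left ((β : ℂ) ^ 2)
  have sb := (hasSum_integral_id_mul_cexp_mul_bose hb hβ).mul_left ((β : ℂ) ^ 2)
  have hβc : (β : ℂ) ≠ 0 := ofReal_ne_zero.2 hβ.ne'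
  have hscale (a : ℂ) (n : ℕ) :
      (β : ℂ) ^ 2 * (1 / (a + n * β) ^ 2) = 1 / (a / β + n) ^ 2 := by
    rw [show a + n * (β : ℂ) = β * (a / β + n) by field_simp, mul_pow, mul_one_div,
      ← div_div, div_self (pow_ne_zero 2 hβc)]
  simp only [hscale] at sa sb
  rw [show ((β : ℂ) + I * z) / β = 1 - -(I * z) / β by field_simp; ring] at sb
  have hre : (-(I * z) / β).re = z.im / β := by simp
  have key := hasSum_one_div_sq_eq (v := -(I * z) / β) (by rw [hre]; positivity)
    (by rw [hre, div_lt_one hβ]; exact h2) sa sb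
  rw [show (π : ℂ) * (-(I * z) / β) = -((π * z / β) * I) by ring, Complex.sin_neg,
    Complex.sin_mul_I, neg_sq, mul_pow, I_sq, ← mul_add] at key
  have hπ : (π : ℂ) ≠ 0 := ofReal_ne_zero.2 Real.pi_ne_zero
  rw [eq_div_of_mul_eq (pow_ne_zero 2 hβc) ((mul_comm _ _).trans key)]
  field_simp
end
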